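/- arXiv:1210.7593 — 7 statements merged into one kernel-verified Lean document; each statement's English description precedes it below -/
import Mathlib

section
/- If (A,B) is a polynomial pair of positive integers, then (A,B) is a palindromic pair, i.e., (A×B)* = A* × B*. -/
/-- The `i`-th base-10 digit of `N` (0 if out of range). -/
def digit (N i : ℕ) : ℕ := (Nat.digits 10 N).getD i 0

/-- The polynomial whose coefficient of `X ^ i` is the `i`-th base-10 digit of `N`. -/
noncomputable def digitPoly (N : ℕ) : Polynomial ℕ :=
  ∑ i ∈ Finset.range (Nat.digits 10 N).length, Polynomial.C (digit N i) * Polynomial.X ^ i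

/-- The base-10 reversal of `N`. -/
def rev (N : ℕ) : ℕ := Nat.ofDigits 10 (Nat.digits 10 N).reverse

/-- The multiplication of `A` by `B` can be performed without carry in base 10:
every convolution sum of digits is at most 9. -/
def NoCarryMul (A B : ℕ) : Prop :=
  ∀ k, ∑ i ∈ Finset.range (k + 1), digit A i * digit B (k - i) ≤ 9

/-- The maximum base-10 digit of `N`. -/
def maxDigit (N : ℕ) : ℕ := (Nat.digits 10 N).foldr max 0

/-- The sum of the base-10 digits of `N`. -/
def digitSum (N : ℕ) : ℕ := (Nat.digits 10 N).sum

/-- The `i`-th base-`b` digit of `N` (0 if out of range). -/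
def digitB (b N i : ℕ) : ℕ := (Nat.digits b N).getD i 0

/-- The base-`b` reversal of `N`. -/
def revB (b N : ℕ) : ℕ := Nat.ofDigits b (Nat.digits b N).reverse

/-- The multiplication of `A` by `B` can be performed without carry in base `b`:
every convolution sum of base-`b` digits is at most `b - 1`. -/
def NoCarryMulB (b A B : ℕ) : Prop :=
  ∀ k, ∑ i ∈ Finset.range (k + 1), digitB b A i * digitB b B (k - i) ≤ b - 1

theorem ofDigits_map_range (b n : ℕ) (f : ℕ → ℕ) :
    Nat.ofDigits b ((List.range n).map f) = ∑ i ∈ Finset.range n, f i * b ^ i := by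
  induction n with
  | zero => simp
  | succ n ih =>
    simp [List.range_succ, Nat.ofDigits_append, ih, Finset.sum_range_succ, mul_comm]

theorem coeff_digitPoly (N k : ℕ) : (digitPoly N).coeff k = digit N k := by
  simp only [digitPoly, Polynomial.finsetSum_coeff, Polynomial.coeff_C_mul_X_pow,
    Finset.sum_ite_eq, Finset.mem_range, ite_eq_left_iff, not_lt]
  intro hk
  simp [digit, hk]

theorem map_digit_range (N : ℕ) :
    (List.range (Nat.digits 10 N).length).map (digit N) = Nat.digits 10 N := by
  refine List.ext_getElem (by simp) fun i _ hi => ?_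
  simp [digit, hi]

theorem eval_digitPoly (N : ℕ) : (digitPoly N).eval 10 = N := by
  conv_rhs => rw [← Nat.ofDigits_digits 10 N, ← map_digit_range, ofDigits_map_range]
  simp [digitPoly, Polynomial.eval_finsetSum]

theorem digit_le_nine (N k : ℕ) : digit N k ≤ 9 := by
  unfold digit
  rw [Nat.getD_digits _ _ (by norm_num)]
  omega

open Polynomial in
theorem digits_eval (P : ℕ[X]) (hP : P ≠ 0) (h : ∀ k, P.coeff k ≤ 9) :
    Nat.digits 10 (P.eval 10) = (List.range (P.natDegree + 1)).map P.coeff := by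
  rw [eval_eq_sum_range, ← ofDigits_map_range]
  refine Nat.digits_ofDigits 10 (by norm_num) _ ?_ ?_
  · simp only [List.mem_map]
    rintro _ ⟨k, _, rfl⟩
    exact Nat.lt_succ_of_le (h k)
  · intro _
    simpa [List.getLast_map] using hP

open Polynomial in
/-- If the coefficients of `P` are decimal digits, reversing the integer `P(10)` amounts to
reversing `P`. -/
theorem rev_eval (P : ℕ[X]) (hP : P ≠ 0) (h : ∀ k, P.coeff k ≤ 9) :
    rev (P.eval 10) = P.reverse.eval 10 := by
  have hrev : ((List.range (P.natDegree + 1)).map P.coeff).reverse =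
      (List.range (P.natDegree + 1)).map P.reverse.coeff := by
    refine List.ext_getElem (by simp) fun i hi _ => ?_
    simp only [List.length_reverse, List.length_map, List.length_range] at hi
    simp [coeff_reverse, revAt_le (Nat.le_of_lt_succ hi)]
  rw [rev, digits_eval P hP h, hrev, ofDigits_map_range,
    eval_eq_sum_range' (Nat.lt_succ_of_le P.reverse_natDegree_le)]

/-- a polynomial pair is a palindromic pair: `(A×B)* = A* × B*`. -/
theorem stmt1 (A B : ℕ) (hA : 0 < A) (hB : 0 < B) (h : NoCarryMul A B) :
    rev (A * B) = rev A * rev B := by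
  have hne : ∀ N, 0 < N → digitPoly N ≠ 0 := fun N hN h0 => by
    have := eval_digitPoly N
    simp only [h0, Polynomial.eval_zero] at this
    omega
  have hdigit : ∀ N k, (digitPoly N).coeff k ≤ 9 := fun N k => by
    rw [coeff_digitPoly]
    exact digit_le_nine N k
  have hprod : ∀ k, (digitPoly A * digitPoly B).coeff k ≤ 9 := fun k => by
    rw [Polynomial.coeff_mul, Finset.Nat.sum_antidiagonal_eq_sum_range_succ_mk]
    simpa only [coeff_digitPoly] using h k
  have hAB := rev_eval _ (mul_ne_zero (hne A hA) (hne B hB)) hprod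
  have hrA := rev_eval _ (hne A hA) (hdigit A)
  have hrB := rev_eval _ (hne B hB) (hdigit B)
  rw [Polynomial.reverse_mul_of_domain, Polynomial.eval_mul, Polynomial.eval_mul, ← hrA, ← hrB] at hAB
  simpa only [eval_digitPoly] using hAB
end

section
/- For all positive integers A and B, (A·B)_∞ ≤ A_∞ · B_1, where N_∞ denotes the maximum base-10 digit of N and N_1 denotes the sum of the base-10 digits of N. -/
theorem maxDigit_zero : maxDigit 0 = 0 := by simp [maxDigit]

theorem maxDigit_eq_max (n : ℕ) : maxDigit n = max (n % 10) (maxDigit (n / 10)) := by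
  rcases Nat.eq_zero_or_pos n with rfl | hn
  · simp [maxDigit]
  · simp [maxDigit, Nat.digits_def' (b := 10) (by norm_num) hn]

theorem maxDigit_le_nine (n : ℕ) : maxDigit n ≤ 9 := by
  induction n using Nat.strong_induction_on with
  | _ n ih =>
    rcases Nat.eq_zero_or_pos n with rfl | hn
    · simp [maxDigit_zero]
    · have := ih (n / 10) (by omega)
      rw [maxDigit_eq_max]
      omega

theorem maxDigit_ten_mul (n : ℕ) : maxDigit (10 * n) = maxDigit n := by
  rw [maxDigit_eq_max]
  simp

theorem maxDigit_add_le (x y : ℕ) : maxDigit (x + y) ≤ maxDigit x + maxDigit y := by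
  induction x using Nat.strong_induction_on generalizing y with
  | _ x ih =>
    rcases Nat.eq_zero_or_pos x with rfl | hx
    · simp [maxDigit_zero]
    · have hle := maxDigit_le_nine (x + y)
      have hrec := ih (x / 10) (by omega) (y / 10)
      have hdx := maxDigit_eq_max x
      have hdy := maxDigit_eq_max y
      by_cases h : x % 10 + y % 10 ≤ 9
      · have hdxy := maxDigit_eq_max (x + y)
        rw [show (x + y) / 10 = x / 10 + y / 10 by omega] at hdxy
        omega
      · omega

theorem maxDigit_mul_le (r n : ℕ) : maxDigit (n * r) ≤ maxDigit n * r := by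
  induction r with
  | zero => simp [maxDigit_zero]
  | succ r ih =>
    rw [Nat.mul_succ, Nat.mul_succ]
    exact (maxDigit_add_le _ _).trans (Nat.add_le_add_right ih _)

theorem digitSum_eq_add {n : ℕ} (hn : 0 < n) : digitSum n = n % 10 + digitSum (n / 10) := by
  simp [digitSum, Nat.digits_def' (b := 10) (by norm_num) hn]

theorem maxDigit_mul_le_mul_digitSum (A B : ℕ) :
    maxDigit (A * B) ≤ maxDigit A * digitSum B := by
  induction B using Nat.strong_induction_on with
  | _ B ih =>
    rcases Nat.eq_zero_or_pos B with rfl | hB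
    · simp [maxDigit_zero]
    · calc maxDigit (A * B) = maxDigit (A * (B % 10) + 10 * (A * (B / 10))) := by
            rw [Nat.mul_left_comm, ← Nat.mul_add, Nat.mod_add_div]
        _ ≤ maxDigit (A * (B % 10)) + maxDigit (10 * (A * (B / 10))) := maxDigit_add_le _ _
        _ ≤ maxDigit A * (B % 10) + maxDigit A * digitSum (B / 10) := by
            rw [maxDigit_ten_mul]
            exact Nat.add_le_add (maxDigit_mul_le _ _) (ih _ (by omega))
        _ = maxDigit A * digitSum B := by rw [digitSum_eq_add hB, Nat.mul_add]

/-- `(A·B)_∞ ≤ A_∞ · B_1`. -/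
theorem stmt4 (A B : ℕ) (hA : 0 < A) (hB : 0 < B) :
    maxDigit (A * B) ≤ maxDigit A * digitSum B := by
  exact maxDigit_mul_le_mul_digitSum A B
end

section
/- Let A and B be positive integers with A_∞ · B_1 ≤ 9, where A_∞ is the maximum base-10 digit of A and B_1 is the sum of the base-10 digits of B. Then (A,B) is a polynomial pair. -/
/-- Every entry of a list (with default `0`) is at most the maximum of the list. -/
theorem List.getD_zero_le_foldr_max (l : List ℕ) (i : ℕ) :
    l.getD i 0 ≤ l.foldr max 0 := by
  induction l generalizing i with
  | nil => simp
  | cons a l ih =>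
    cases i with
    | zero => simp
    | succ i => simpa using Or.inr (ih i)

/-- The sum of an initial segment of a list of naturals is at most the sum of the list. -/
theorem List.sum_range_getD_zero_le_sum (l : List ℕ) (n : ℕ) :
    ∑ i ∈ Finset.range n, l.getD i 0 ≤ l.sum := by
  induction l generalizing n with
  | nil => simp
  | cons a l ih =>
    cases n with
    | zero => simp
    | succ n =>
      rw [Finset.sum_range_succ', List.sum_cons, add_comm]
      simpa using ih n

/-- if `A_∞ · B_1 ≤ 9` then `(A,B)` is a polynomial pair. -/
theorem stmt5 (A B : ℕ) (hA : 0 < A) (hB : 0 < B)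
    (h : maxDigit A * digitSum B ≤ 9) : NoCarryMul A B := by
  intro k
  calc ∑ i ∈ Finset.range (k + 1), digit A i * digit B (k - i)
      ≤ ∑ i ∈ Finset.range (k + 1), maxDigit A * digit B (k - i) :=
        Finset.sum_le_sum fun i _ =>
          Nat.mul_le_mul_right _ (List.getD_zero_le_foldr_max _ i)
    _ = maxDigit A * ∑ i ∈ Finset.range (k + 1), digit B i := by
        rw [← Finset.mul_sum, ← Finset.sum_range_reflect (digit B) (k + 1)]
        simp
    _ ≤ maxDigit A * digitSum B :=
        Nat.mul_le_mul_left _ (List.sum_range_getD_zero_le_sum _ _)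
    _ ≤ 9 := h
end

section
/- Let n ≥ 2 and let S and T be nonempty disjoint sets with S ∪ T = {0, 1, ..., n−1}. Set A = ∏_{i∈S} (10^{2^i} + 1) and B = ∏_{i∈T} (10^{2^i} + 1). Then (A,B) is a polynomial pair and A × B = R(2^n), the repunit with 2^n digits. -/
open Polynomial in
/-- If all coefficients of a polynomial are less than `b`, they are the base-`b` digits of its
value at `b`. -/
theorem eval_div_pow_mod_eq_coeff {b : ℕ} (i : ℕ) (P : ℕ[X]) (hP : ∀ k, P.coeff k < b) :
    P.eval b / b ^ i % b = P.coeff i := by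
  have hb : 0 < b := (Nat.zero_le _).trans_lt (hP 0)
  have hdecomp : P.eval b = P.coeff 0 + b * P.divX.eval b := by
    conv_lhs => rw [← P.divX_mul_X_add]
    simp only [eval_add, eval_mul, eval_X, eval_C]
    ring
  induction i generalizing P with
  | zero => rw [hdecomp, pow_zero, Nat.div_one, Nat.add_mul_mod_self_left, Nat.mod_eq_of_lt (hP 0)]
  | succ i ih =>
    rw [pow_succ', ← Nat.div_div_eq_div_mul, hdecomp, Nat.add_mul_div_left _ _ hb,
      Nat.div_eq_of_lt (hP 0), zero_add, ih P.divX (fun k => by simpa using hP (k + 1)), coeff_divX]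
    conv_lhs => rw [← P.divX.divX_mul_X_add]
    simp only [eval_add, eval_mul, eval_X, eval_C]
    ring

open Polynomial in
theorem digit_eval_ten (P : ℕ[X]) (hP : ∀ k, P.coeff k < 10) (i : ℕ) :
    digit (P.eval 10) i = P.coeff i := by
  rw [digit, Nat.getD_digits _ _ (by norm_num)]
  exact eval_div_pow_mod_eq_coeff i P hP

open Polynomial in
/-- Two polynomials with constant coefficient `1` whose product has all coefficients at most `9`
take values at `10` that multiply without carry. -/
theorem noCarryMul_eval_ten {P Q : ℕ[X]} (hP : P.coeff 0 = 1) (hQ : Q.coeff 0 = 1)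
    (hPQ : ∀ k, (P * Q).coeff k ≤ 9) : NoCarryMul (P.eval 10) (Q.eval 10) := by
  have hle : ∀ {P Q : ℕ[X]} (_ : Q.coeff 0 = 1) (k : ℕ), P.coeff k ≤ (P * Q).coeff k := by
    intro P Q hQ k
    rw [coeff_mul]
    calc P.coeff k = P.coeff k * Q.coeff 0 := by rw [hQ, mul_one]
      _ ≤ _ := Finset.single_le_sum (f := fun x : ℕ × ℕ => P.coeff x.1 * Q.coeff x.2)
        (fun _ _ => Nat.zero_le _) (a := (k, 0)) (by simp)
  have hP9 : ∀ k, P.coeff k < 10 := fun k => Nat.lt_succ_of_le ((hle hQ k).trans (hPQ k))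
  have hQ9 : ∀ k, Q.coeff k < 10 := fun k =>
    Nat.lt_succ_of_le ((hle hP k).trans (by rw [mul_comm]; exact hPQ k))
  intro k
  simp only [digit_eval_ten P hP9, digit_eval_ten Q hQ9]
  rw [← Finset.Nat.sum_antidiagonal_eq_sum_range_succ (fun i j => P.coeff i * Q.coeff j),
    ← coeff_mul]
  exact hPQ k

theorem prod_range_pow_two_pow_add_one {R : Type*} [CommSemiring R] (x : R) (n : ℕ) :
    ∏ i ∈ Finset.range n, (x ^ 2 ^ i + 1) = ∑ k ∈ Finset.range (2 ^ n), x ^ k := by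
  induction n with
  | zero => simp
  | succ n ih =>
    rw [Finset.prod_range_succ, ih, pow_succ 2 n, mul_two, Finset.sum_range_add, mul_add, mul_one,
      add_comm, Finset.sum_mul]
    simp only [pow_add, mul_comm]

open Polynomial in
theorem coeff_zero_prod_X_pow_add_one (S : Finset ℕ) :
    (∏ i ∈ S, (X ^ 2 ^ i + 1) : ℕ[X]).coeff 0 = 1 := by
  simp [coeff_zero_eq_eval_zero, eval_prod]

/-- grouping the factors `10^(2^i) + 1`, `0 ≤ i < n`, into two nonempty
disjoint sets yields a polynomial pair whose product is the repunit `R(2^n)`. -/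
theorem stmt7 (n : ℕ) (hn : 2 ≤ n) (S T : Finset ℕ) (hS : S.Nonempty) (hT : T.Nonempty)
    (hdisj : Disjoint S T) (hunion : S ∪ T = Finset.range n) :
    NoCarryMul (∏ i ∈ S, (10 ^ 2 ^ i + 1)) (∏ i ∈ T, (10 ^ 2 ^ i + 1)) ∧
      (∏ i ∈ S, (10 ^ 2 ^ i + 1)) * (∏ i ∈ T, (10 ^ 2 ^ i + 1)) = (10 ^ 2 ^ n - 1) / 9 := by
  have heval : ∀ U : Finset ℕ, ∏ i ∈ U, (10 ^ 2 ^ i + 1) =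
      (∏ i ∈ U, (Polynomial.X ^ 2 ^ i + 1) : Polynomial ℕ).eval 10 := by
    intro U
    simp [Polynomial.eval_prod]
  constructor
  · rw [heval S, heval T]
    refine noCarryMul_eval_ten (coeff_zero_prod_X_pow_add_one S)
      (coeff_zero_prod_X_pow_add_one T) fun k => ?_
    rw [← Finset.prod_union hdisj, hunion, prod_range_pow_two_pow_add_one,
      Polynomial.finsetSum_coeff]
    simp only [Polynomial.coeff_X_pow, Finset.sum_ite_eq]
    split_ifs <;> norm_num
  · rw [← Finset.prod_union hdisj, hunion, prod_range_pow_two_pow_add_one,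
      Nat.geomSum_eq (by norm_num)]
end

section
/- Let A be a positive integer and A* its base-10 reversal. If the sum of the squares of the base-10 digits of A is at most 9, then (A, A*) is a polynomial pair. -/
theorem digit_ofDigits (l : List ℕ) (hl : ∀ d ∈ l, d < 10) (i : ℕ) :
    digit (Nat.ofDigits 10 l) i = l.getD i 0 := by
  unfold digit
  rw [Nat.getD_digits _ _ (by norm_num)]
  induction l generalizing i with
  | nil => simp
  | cons a l ih =>
    have ha : a < 10 := hl a (by simp)
    have ih' := fun i => ih (fun d hd => hl d (by simp [hd])) i
    rw [Nat.ofDigits_cons]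
    cases i with
    | zero => simp; omega
    | succ i =>
      rw [List.getD_cons_succ, ← ih' i, pow_succ', ← Nat.div_div_eq_div_mul]
      congr 2
      omega

theorem sum_range_getD_sq_le (l : List ℕ) (m : ℕ) :
    ∑ i ∈ Finset.range m, (l.getD i 0) ^ 2 ≤ (l.map (· ^ 2)).sum := by
  induction l generalizing m with
  | nil => simp
  | cons a l ih =>
    cases m with
    | zero => simp
    | succ m =>
      rw [Finset.sum_range_succ']
      have := ih m
      simp only [List.getD_cons_succ, List.getD_cons_zero, List.map_cons, List.sum_cons]
      omega

/-- if the sum of the squares of the base-10 digits of `A` is at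
most 9, then `(A, A*)` is a polynomial pair. -/
theorem stmt11 (A : ℕ) (hA : 0 < A)
    (h : ((Nat.digits 10 A).map (· ^ 2)).sum ≤ 9) : NoCarryMul A (rev A) := by
  intro k
  have hrev : ∀ j, digit (rev A) j = (Nat.digits 10 A).reverse.getD j 0 :=
    digit_ofDigits _ fun d hd =>
      Nat.digits_lt_base (by norm_num) (List.mem_reverse.mp hd)
  have h₁ : ∑ i ∈ Finset.range (k + 1), digit A i ^ 2 ≤ 9 :=
    (sum_range_getD_sq_le _ _).trans h
  have h₂ : ∑ i ∈ Finset.range (k + 1), digit (rev A) (k - i) ^ 2 ≤ 9 := by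
    rw [Finset.sum_flip (fun j => digit (rev A) j ^ 2)]
    simp only [hrev]
    refine (sum_range_getD_sq_le _ _).trans ?_
    rwa [List.map_reverse, List.sum_reverse]
  have h₃ : 2 * ∑ i ∈ Finset.range (k + 1), digit A i * digit (rev A) (k - i) ≤
      ∑ i ∈ Finset.range (k + 1), digit A i ^ 2 +
        ∑ i ∈ Finset.range (k + 1), digit (rev A) (k - i) ^ 2 := by
    rw [Finset.mul_sum, ← Finset.sum_add_distrib]
    refine Finset.sum_le_sum fun i _ => ?_
    rw [← mul_assoc]
    exact two_mul_le_add_sq _ _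
  omega
end

section
/- Let r ≥ 2 be an integer and set b = r² − 1. Then for every non-negative integer j, the integer A = r·(b^{j+2} + 1) satisfies: the list of base-b digits of A² is a palindrome, yet the base-b multiplication of A by itself cannot be performed without carry (i.e., there is some k for which the convolution sum ∑_{i+l=k} a_i a_l of the base-b digits of A exceeds b − 1). Explicitly, A² = b^{2j+5} + b^{2j+4} + 2·b^{j+3} + 2·b^{j+2} + b + 1. -/
/-- The base-`b` digits of `b^(2j+5) + b^(2j+4) + 2·b^(j+3) + 2·b^(j+2) + b + 1`. -/
theorem digits_symmetric_sum {b : ℕ} (hb : 3 ≤ b) (j : ℕ) :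
    Nat.digits b
        (b ^ (2 * j + 5) + b ^ (2 * j + 4) + 2 * b ^ (j + 3) + 2 * b ^ (j + 2) + b + 1) =
      [1, 1] ++ (List.replicate j 0 ++ ([2, 2] ++ (List.replicate j 0 ++ [1, 1]))) := by
  have hval : b ^ (2 * j + 5) + b ^ (2 * j + 4) + 2 * b ^ (j + 3) + 2 * b ^ (j + 2) + b + 1 =
      Nat.ofDigits b
        ([1, 1] ++ (List.replicate j 0 ++ ([2, 2] ++ (List.replicate j 0 ++ [1, 1])))) := by
    simp only [List.cons_append, List.nil_append, Nat.ofDigits_cons, Nat.ofDigits_nil,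
      Nat.ofDigits_append, Nat.ofDigits_replicate_zero, List.length_replicate]
    ring
  rw [hval]
  refine Nat.digits_ofDigits b (by omega) _ ?_ ?_
  · intro l hl
    simp only [List.mem_append, List.mem_cons, List.mem_replicate, List.not_mem_nil, or_false] at hl
    omega
  · intro _
    simp

/-- for `b = r² - 1` with `r ≥ 2` and `A = r·(b^(j+2) + 1)`, the base-`b`
digit list of `A²` is a palindrome, the base-`b` multiplication of `A` by itself cannot
be performed without carry, and explicitly
`A² = b^(2j+5) + b^(2j+4) + 2·b^(j+3) + 2·b^(j+2) + b + 1`. -/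
theorem stmt13 (r : ℕ) (hr : 2 ≤ r) (b : ℕ) (hb : b = r ^ 2 - 1) (j : ℕ) (A : ℕ)
    (hA : A = r * (b ^ (j + 2) + 1)) :
    List.Palindrome (Nat.digits b (A * A)) ∧
      (∃ k, b - 1 < ∑ i ∈ Finset.range (k + 1), digitB b A i * digitB b A (k - i)) ∧
      A * A = b ^ (2 * j + 5) + b ^ (2 * j + 4) + 2 * b ^ (j + 3) + 2 * b ^ (j + 2) + b + 1 := by
  have hr2 : r ^ 2 = b + 1 := by
    have : 0 < r ^ 2 := by positivity
    omega
  have hrb : r < b := by nlinarith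
  have hval : A * A =
      b ^ (2 * j + 5) + b ^ (2 * j + 4) + 2 * b ^ (j + 3) + 2 * b ^ (j + 2) + b + 1 := by
    calc A * A = r ^ 2 * (b ^ (j + 2) + 1) ^ 2 := by rw [hA]; ring
      _ = _ := by rw [hr2]; ring
  refine ⟨?_, ⟨0, ?_⟩, hval⟩
  · rw [hval, digits_symmetric_sum (by omega) j]
    apply List.Palindrome.of_reverse_eq
    simp
  · have hdigit : digitB b A 0 = r := by
      have hA' : A = r + b * (r * b ^ (j + 1)) := by rw [hA]; ring
      rw [digitB, Nat.getD_digits _ _ (by omega), pow_zero, Nat.div_one, hA',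
        Nat.add_mul_mod_self_left, Nat.mod_eq_of_lt hrb]
    simp only [zero_add, Finset.sum_range_one, hdigit, Nat.sub_zero]
    rw [← sq, hr2]
    omega
end

section
/- There are infinitely many integer bases b ≥ 2 for which there exists a positive integer A such that A × A* is a base-b palindrome (where A* is the base-b reversal of A), yet the base-b multiplication of A by A* cannot be performed without carry (i.e., (A, A*) is not a polynomial pair in base b). -/
/-- A single digit is its own reversal. -/
theorem revB_of_lt {b d : ℕ} (hd : 0 < d) (hdb : d < b) : revB b d = d := by
  simp [revB, Nat.digits_of_lt b d hd.ne' hdb]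

/-- The number with base-`b` digits `11` is a palindrome. -/
theorem revB_one_add_self {b : ℕ} (hb : 2 ≤ b) : revB b (1 + b) = 1 + b := by
  have h : Nat.digits b (1 + b * 1) = [1, 1] := by
    rw [Nat.digits_add b hb 1 1 hb (Or.inl one_ne_zero),
      Nat.digits_of_lt b 1 one_ne_zero hb]
  rw [mul_one] at h
  simp [revB, h, Nat.ofDigits_cons]

/-- A product of single digits that is at least the base needs a carry. -/
theorem not_noCarryMulB_of_le_mul {b c d : ℕ} (hc : 0 < c) (hcb : c < b) (hd : 0 < d)
    (hdb : d < b) (h : b ≤ c * d) : ¬ NoCarryMulB b c d := by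
  intro H
  have h0 := H 0
  simp [digitB, Nat.digits_of_lt b c hc.ne' hcb, Nat.digits_of_lt b d hd.ne' hdb] at h0
  omega

/-- there are infinitely many bases `b ≥ 2` admitting a positive integer `A`
such that `A × A*` is a base-`b` palindrome while `(A, A*)` is not a polynomial pair
in base `b`. -/
theorem stmt14 :
    {b : ℕ | 2 ≤ b ∧ ∃ A : ℕ, 0 < A ∧
      revB b (A * revB b A) = A * revB b A ∧ ¬ NoCarryMulB b A (revB b A)}.Infinite := by
  -- In base `n ^ 2 - 1` the digit `n` has square `11`; take `n = m + 3`.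
  refine Set.infinite_of_injective_forall_mem (f := fun m : ℕ => m * m + 6 * m + 8) ?_ ?_
  · intro m k h
    simp only at h
    nlinarith
  · intro m
    have hlt : m + 3 < m * m + 6 * m + 8 := by nlinarith
    have hsq : (m + 3) * (m + 3) = 1 + (m * m + 6 * m + 8) := by ring
    refine ⟨by omega, m + 3, by omega, ?_, ?_⟩
    · rw [revB_of_lt (by omega) hlt, hsq]
      exact revB_one_add_self (by omega)
    · rw [revB_of_lt (by omega) hlt]
      exact not_noCarryMulB_of_le_mul (by omega) hlt (by omega) hlt (by omega)
end
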